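/- arXiv:1908.06934 — 2 statements merged into one kernel-verified Lean document; each statement's English description precedes it below -/
import Mathlib

section
/- Let Σ be a symmetric positive definite d×d real matrix partitioned into N×N blocks, μ ∈ ℝ^d, and f the Gaussian density with mean μ and covariance Σ. Define j_d(x) = (1/2)(x−μ)ᵀ Φ (x−μ) with Φ = D⁻¹ − Σ⁻¹. Then there exists ε > 0 such that for all real t with |t| < ε, ∫_{ℝ^d} f(x) · exp( t · j_d(x) ) dx = det(I_d − t Γ)^{−1/2}. -/
open MeasureTheory Matrix Real

noncomputable section

/-- Index type for a vector partitioned into `N` blocks of sizes `d 0, …, d (N-1)`. -/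
abbrev blockIdx {N : ℕ} (d : Fin N → ℕ) : Type := (n : Fin N) × Fin (d n)

/-- The `(m, n)` block of a partitioned matrix. -/
def blockOf {N : ℕ} (d : Fin N → ℕ) (S : Matrix (blockIdx d) (blockIdx d) ℝ)
    (m n : Fin N) : Matrix (Fin (d m)) (Fin (d n)) ℝ :=
  Matrix.of fun i j => S ⟨m, i⟩ ⟨n, j⟩

/-- The block-diagonal matrix `diag (Σ₁₁, …, Σ_NN)` with the same diagonal blocks as `S`. -/
def blockDiagPart {N : ℕ} (d : Fin N → ℕ) (S : Matrix (blockIdx d) (blockIdx d) ℝ) :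
    Matrix (blockIdx d) (blockIdx d) ℝ :=
  Matrix.of fun i j => if i.1 = j.1 then S i j else 0

/-- The multivariate normal density with mean `μ` and covariance matrix `S`. -/
def gaussDensity {ι : Type*} [Fintype ι] [DecidableEq ι]
    (μ : ι → ℝ) (S : Matrix ι ι ℝ) (x : ι → ℝ) : ℝ :=
  (Real.sqrt ((2 * π) ^ (Fintype.card ι) * S.det))⁻¹ *
    Real.exp (-(1 / 2) * ((x - μ) ⬝ᵥ (S⁻¹ *ᵥ (x - μ))))

/-- A real positive definite matrix is a Gram matrix `Bᵀ B` with `B` invertible. -/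
theorem Matrix.PosDef.exists_transpose_mul_self {ι : Type*} [Fintype ι] [DecidableEq ι]
    {A : Matrix ι ι ℝ} (hA : A.PosDef) : ∃ B : Matrix ι ι ℝ, IsUnit B ∧ A = Bᵀ * B := by
  open scoped MatrixOrder Matrix.Norms.L2Operator in
  obtain ⟨B, hB, h⟩ := CStarAlgebra.isStrictlyPositive_iff_eq_star_mul_self.mp
    hA.isStrictlyPositive
  exact ⟨B, hB, by rw [h, star_eq_conjTranspose, conjTranspose_eq_transpose_of_trivial]⟩

/-- The quadratic form of a real matrix is bounded by a multiple of the squared Euclidean norm. -/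
theorem Matrix.abs_dotProduct_mulVec_self_le {ι : Type*} [Fintype ι] (M : Matrix ι ι ℝ)
    (x : ι → ℝ) : |x ⬝ᵥ (M *ᵥ x)| ≤ (∑ i, ∑ j, |M i j|) * (x ⬝ᵥ x) := by
  have entry (k : ι) : x k ^ 2 ≤ x ⬝ᵥ x := by
    simp only [dotProduct, ← pow_two]
    exact Finset.single_le_sum (f := fun k => x k ^ 2) (fun _ _ => sq_nonneg _) (Finset.mem_univ k)
  have expand : x ⬝ᵥ (M *ᵥ x) = ∑ i, ∑ j, x i * (M i j * x j) := by
    simp only [dotProduct, mulVec, Finset.mul_sum]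
  rw [expand, Finset.sum_mul]
  refine (Finset.abs_sum_le_sum_abs _ _).trans (Finset.sum_le_sum fun i _ => ?_)
  rw [Finset.sum_mul]
  refine (Finset.abs_sum_le_sum_abs _ _).trans (Finset.sum_le_sum fun j _ => ?_)
  have product : |x i| * |x j| ≤ x ⬝ᵥ x := by
    nlinarith [entry i, entry j, sq_nonneg (|x i| - |x j|), sq_abs (x i), sq_abs (x j)]
  calc |x i * (M i j * x j)| = |M i j| * (|x i| * |x j|) := by simp only [abs_mul]; ring
    _ ≤ |M i j| * (x ⬝ᵥ x) := by gcongr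

/-- Small symmetric perturbations of the identity are positive definite. -/
theorem Matrix.IsHermitian.exists_posDef_one_sub_smul {ι : Type*} [Fintype ι] [DecidableEq ι]
    {M : Matrix ι ι ℝ} (hM : M.IsHermitian) :
    ∃ ε > 0, ∀ t : ℝ, |t| < ε → (1 - t • M).PosDef := by
  set C : ℝ := ∑ i, ∑ j, |M i j|
  have hC0 : 0 ≤ C := Finset.sum_nonneg fun i _ => Finset.sum_nonneg fun j _ => abs_nonneg _
  refine ⟨1 / (C + 1), by positivity, fun t ht => ?_⟩
  refine PosDef.of_dotProduct_mulVec_pos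
    (isHermitian_one.sub (hM.smul (IsSelfAdjoint.all t))) fun x hx => ?_
  have hpos : 0 < x ⬝ᵥ x := by
    simpa using (dotProduct_star_self_pos_iff (v := x)).mpr hx
  have hlt : |t| * (C + 1) < 1 := (lt_div_iff₀ (by positivity)).mp ht
  have hbound : t * (x ⬝ᵥ (M *ᵥ x)) ≤ |t| * (C * (x ⬝ᵥ x)) := by
    refine (le_abs_self _).trans ?_
    rw [abs_mul]
    exact mul_le_mul_of_nonneg_left (abs_dotProduct_mulVec_self_le M x) (abs_nonneg t)
  rw [star_trivial, sub_mulVec, one_mulVec, dotProduct_sub, smul_mulVec, dotProduct_smul,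
    smul_eq_mul]
  nlinarith [mul_pos (sub_pos.mpr hlt) hpos, mul_nonneg (abs_nonneg t) hpos.le]

/-- Positive definiteness is stable under small symmetric perturbations. -/
theorem Matrix.PosDef.exists_posDef_sub_smul {ι : Type*} [Fintype ι] [DecidableEq ι]
    {A M : Matrix ι ι ℝ} (hA : A.PosDef) (hM : M.IsHermitian) :
    ∃ ε > 0, ∀ t : ℝ, |t| < ε → (A - t • M).PosDef := by
  obtain ⟨B, hB, rfl⟩ := hA.exists_transpose_mul_self
  have hdet : IsUnit B.det := (isUnit_iff_isUnit_det B).mp hB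
  obtain ⟨ε, hε, h⟩ :=
    (isHermitian_conjTranspose_mul_mul B⁻¹ hM).exists_posDef_one_sub_smul
  refine ⟨ε, hε, fun t ht => ?_⟩
  have key := (IsUnit.posDef_star_left_conjugate_iff hB).mpr (h t ht)
  have hcancel : Bᵀ * (B⁻¹ᵀ * M * B⁻¹) * B = M := by
    calc Bᵀ * (B⁻¹ᵀ * M * B⁻¹) * B = (B⁻¹ * B)ᵀ * M * (B⁻¹ * B) := by
          simp only [transpose_mul, Matrix.mul_assoc]
      _ = M := by simp [nonsing_inv_mul B hdet]
  rwa [star_eq_conjTranspose, conjTranspose_eq_transpose_of_trivial,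
    conjTranspose_eq_transpose_of_trivial, Matrix.mul_sub, Matrix.sub_mul, Matrix.mul_one,
    Matrix.mul_smul, Matrix.smul_mul, hcancel] at key

/-- The Gaussian integral of a positive definite quadratic form. -/
theorem Matrix.PosDef.integral_exp_neg_half {ι : Type*} [Fintype ι] [DecidableEq ι]
    {A : Matrix ι ι ℝ} (hA : A.PosDef) :
    ∫ x : ι → ℝ, Real.exp (-(1 / 2) * (x ⬝ᵥ (A *ᵥ x))) =
      √((2 * π) ^ Fintype.card ι / A.det) := by
  obtain ⟨B, hB, rfl⟩ := hA.exists_transpose_mul_self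
  have hdet : B.det ≠ 0 := ((isUnit_iff_isUnit_det B).mp hB).ne_zero
  have standard : ∫ y : ι → ℝ, Real.exp (-(1 / 2) * (y ⬝ᵥ y)) =
      √(2 * π) ^ Fintype.card ι := by
    have hprod (y : ι → ℝ) : Real.exp (-(1 / 2) * (y ⬝ᵥ y)) =
        ∏ i, Real.exp (-(1 / 2) * y i ^ 2) := by
      rw [← Real.exp_sum, ← Finset.mul_sum]
      simp only [dotProduct, pow_two]
    simp only [hprod]
    rw [integral_fintype_prod_volume_eq_pow fun y : ℝ => Real.exp (-(1 / 2) * y ^ 2),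
      integral_gaussian]
    congr 2
    ring
  have hform (x : ι → ℝ) : x ⬝ᵥ ((Bᵀ * B) *ᵥ x) = toLin' B x ⬝ᵥ toLin' B x := by
    rw [toLin'_apply, ← mulVec_mulVec, dotProduct_mulVec, vecMul_transpose]
  have hcont : Continuous fun y : ι → ℝ => Real.exp (-(1 / 2) * (y ⬝ᵥ y)) := by
    simp only [dotProduct]
    fun_prop
  simp only [hform]
  rw [← integral_map (φ := toLin' B) (μ := volume)
      (f := fun y : ι → ℝ => Real.exp (-(1 / 2) * (y ⬝ᵥ y)))
      (LinearMap.continuous_of_finiteDimensional _).aemeasurable hcont.aestronglyMeasurable,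
    Real.map_matrix_volume_pi_eq_smul_volume_pi hdet, integral_smul_measure, standard,
    ENNReal.toReal_ofReal (abs_nonneg _), det_mul, det_transpose, ← pow_two,
    Real.sqrt_div (by positivity), Real.sqrt_sq_eq_abs, abs_inv, smul_eq_mul, div_eq_inv_mul]
  congr 1
  rw [eq_comm, Real.sqrt_eq_iff_eq_sq (by positivity) (by positivity), ← pow_mul, mul_comm _ 2,
    pow_mul, Real.sq_sqrt (by positivity)]

/-- The block-diagonal part of a symmetric matrix is symmetric. -/
theorem blockDiagPart_isHermitian {N : ℕ} (d : Fin N → ℕ)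
    {S : Matrix (blockIdx d) (blockIdx d) ℝ} (hS : S.IsHermitian) :
    (blockDiagPart d S).IsHermitian := by
  ext i j
  have hij : S j i = S i j := by simpa using hS.apply i j
  simp [blockDiagPart, eq_comm, hij]

/-- The moment generating function of a quadratic form in a Gaussian vector, wherever the
exponent stays negative definite. -/
theorem integral_gaussDensity_mul_exp {ι : Type*} [Fintype ι] [DecidableEq ι] (μ : ι → ℝ)
    {S M : Matrix ι ι ℝ} (hS : S.PosDef) {t : ℝ} (hA : (S⁻¹ - t • M).PosDef) :
    ∫ x : ι → ℝ, gaussDensity μ S x * Real.exp (t * ((1 / 2) * ((x - μ) ⬝ᵥ (M *ᵥ (x - μ))))) =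
      (1 - t • (S * M)).det ^ (-(1 : ℝ) / 2) := by
  have hcombine (x : ι → ℝ) :
      gaussDensity μ S x * Real.exp (t * ((1 / 2) * ((x - μ) ⬝ᵥ (M *ᵥ (x - μ))))) =
        (√((2 * π) ^ Fintype.card ι * S.det))⁻¹ *
          Real.exp (-(1 / 2) * ((x - μ) ⬝ᵥ ((S⁻¹ - t • M) *ᵥ (x - μ)))) := by
    rw [gaussDensity, mul_assoc, ← Real.exp_add, sub_mulVec, dotProduct_sub, smul_mulVec,
      dotProduct_smul, smul_eq_mul]
    congr 2
    ring
  have hdet : (1 - t • (S * M)).det = S.det * (S⁻¹ - t • M).det := by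
    rw [← det_mul, Matrix.mul_sub, mul_nonsing_inv S hS.det_pos.ne'.isUnit, Matrix.mul_smul]
  have hS0 := hS.det_pos
  have hA0 := hA.det_pos
  simp only [hcombine]
  rw [integral_const_mul,
    integral_sub_right_eq_self
      (fun y : ι → ℝ => Real.exp (-(1 / 2) * (y ⬝ᵥ ((S⁻¹ - t • M) *ᵥ y)))) μ,
    hA.integral_exp_neg_half, hdet, neg_div, Real.rpow_neg (by positivity), ← Real.sqrt_eq_rpow,
    ← Real.sqrt_inv, ← Real.sqrt_inv, ← Real.sqrt_mul (by positivity)]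
  congr 1
  field_simp

/-- The moment-generating function of `j_d(x) = ½ (x−μ)ᵀ Φ (x−μ)`, with
`Φ = D⁻¹ − Σ⁻¹`, under the Gaussian density with mean `μ` and covariance `Σ`,
equals `det(I − tΓ)^(−1/2)` for `t` in a neighborhood of `0`. -/
theorem mgf_jd {N : ℕ} (hN : 2 ≤ N) (d : Fin N → ℕ)
    (S : Matrix (blockIdx d) (blockIdx d) ℝ) (hS : S.PosDef) (μ : blockIdx d → ℝ) :
    ∃ ε > 0, ∀ t : ℝ, |t| < ε →
      (∫ x : blockIdx d → ℝ,
          gaussDensity μ S x *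
            Real.exp (t * ((1 / 2) *
              ((x - μ) ⬝ᵥ (((blockDiagPart d S)⁻¹ - S⁻¹) *ᵥ (x - μ)))))) =
        ((1 - t • (S * (blockDiagPart d S)⁻¹ - 1)).det) ^ (-(1 : ℝ) / 2) := by
  have hΦ : ((blockDiagPart d S)⁻¹ - S⁻¹).IsHermitian :=
    (blockDiagPart_isHermitian d hS.isHermitian).inv.sub hS.isHermitian.inv
  obtain ⟨ε, hε, h⟩ := hS.inv.exists_posDef_sub_smul hΦ
  refine ⟨ε, hε, fun t ht => ?_⟩
  rw [integral_gaussDensity_mul_exp μ hS (h t ht), Matrix.mul_sub,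
    mul_nonsing_inv S hS.det_pos.ne'.isUnit]
end
end

section
/- Let Σ be a symmetric positive definite d×d real matrix partitioned into N×N blocks and Γ = Σ·D⁻¹ − I_d. For every integer l ≥ 1, the l-th iterated derivative at t = 0 of the function t ↦ −(1/2)·ln det(I_d − t Γ) equals ((l−1)!/2)·tr(Γ^l). In particular, since tr(Γ) = 0, the first derivative at 0 vanishes, and the cumulants of order l ≥ 2 of the multiinformation density are κ_l = ((l−1)!/2)·tr(Γ^l). -/
open MeasureTheory Matrix Real

noncomputable section

section Resolvent

open scoped Matrix.Norms.Operator

variable {n : Type*} [Fintype n] [DecidableEq n]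

theorem Matrix.hasDerivAt_det_one_add_smul_zero (M : Matrix n n ℝ) :
    HasDerivAt (fun r : ℝ => (1 + r • M).det) M.trace 0 := by
  simp_rw [Matrix.det_one_add_smul _ M]
  set q := (det (1 + (Polynomial.X : Polynomial ℝ) • M.map Polynomial.C)).divX.divX
  have h := (((hasDerivAt_id (0 : ℝ)).const_mul M.trace).const_add 1).add
    ((q.hasDerivAt 0).mul ((hasDerivAt_id (0 : ℝ)).pow 2))
  simpa using! h

/-- Jacobi's formula along the line `t ↦ 1 - t • A`. -/
theorem Matrix.hasDerivAt_det_one_sub_smul (A : Matrix n n ℝ) {t : ℝ}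
    (ht : (1 - t • A).det ≠ 0) :
    HasDerivAt (fun s : ℝ => (1 - s • A).det)
      (-((1 - t • A).det * ((1 - t • A)⁻¹ * A).trace)) t := by
  have hfac : (fun s : ℝ => (1 - s • A).det) = fun s =>
      (1 - t • A).det * (1 + (s - t) • -((1 - t • A)⁻¹ * A)).det := by
    funext s
    rw [← det_mul, mul_add, mul_one, mul_smul_comm, mul_neg,
      mul_nonsing_inv_cancel_left _ _ ht.isUnit]
    congr 1
    module
  rw [hfac]
  have h := Matrix.hasDerivAt_det_one_add_smul_zero (-((1 - t • A)⁻¹ * A))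
  rw [← sub_self t] at h
  simpa using! (h.comp_sub_const t t).const_mul (1 - t • A).det

theorem Matrix.hasDerivAt_log_det_one_sub_smul (A : Matrix n n ℝ) {t : ℝ}
    (ht : (1 - t • A).det ≠ 0) :
    HasDerivAt (fun s : ℝ => Real.log (1 - s • A).det) (-((1 - t • A)⁻¹ * A).trace) t := by
  convert (A.hasDerivAt_det_one_sub_smul ht).log ht using 1
  field_simp

theorem Matrix.hasDerivAt_inv_one_sub_smul_mul (A : Matrix n n ℝ) {t : ℝ}
    (ht : (1 - t • A).det ≠ 0) :
    HasDerivAt (fun s : ℝ => (1 - s • A)⁻¹ * A) (((1 - t • A)⁻¹ * A) ^ 2) t := by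
  have hline : HasDerivAt (fun s : ℝ => 1 - s • A) (-A) t := by
    simpa using! ((hasDerivAt_id t).smul_const A).const_sub 1
  have hinv : HasFDerivAt Ring.inverse _ (1 - t • A) :=
    hasFDerivAt_ringInverse (𝕜 := ℝ) (nonsingInvUnit _ ht.isUnit)
  simp_rw [nonsing_inv_eq_ringInverse]
  refine ((hinv.comp_hasDerivAt t hline).mul_const A).congr_deriv ?_
  simp [pow_two, mul_assoc, ← nonsing_inv_eq_ringInverse]
  rfl

theorem Matrix.hasDerivAt_trace_inv_one_sub_smul_mul_pow (A : Matrix n n ℝ) {t : ℝ}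
    (ht : (1 - t • A).det ≠ 0) (k : ℕ) :
    HasDerivAt (fun s : ℝ => (((1 - s • A)⁻¹ * A) ^ k).trace)
      (k * (((1 - t • A)⁻¹ * A) ^ (k + 1)).trace) t := by
  have hpow : HasDerivAt (fun s : ℝ => ((1 - s • A)⁻¹ * A) ^ k)
      ((k : ℝ) • ((1 - t • A)⁻¹ * A) ^ (k + 1)) t := by
    induction k with
    | zero => simpa using! hasDerivAt_const t (1 : Matrix n n ℝ)
    | succ k ih =>
      simp_rw [pow_succ _ k]
      refine (ih.mul (A.hasDerivAt_inv_one_sub_smul_mul ht)).congr_deriv ?_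
      rw [smul_mul_assoc, ← pow_succ, ← pow_add]
      push_cast
      module
  refine ((LinearMap.toContinuousLinearMap
    (traceLinearMap n ℝ ℝ)).hasFDerivAt.comp_hasDerivAt t hpow).congr_deriv ?_
  exact trace_smul _ _

theorem Matrix.iteratedDeriv_log_det_one_sub_smul (A : Matrix n n ℝ) (l : ℕ) {t : ℝ}
    (ht : (1 - t • A).det ≠ 0) :
    iteratedDeriv (l + 1) (fun s : ℝ => Real.log (1 - s • A).det) t =
      -(l.factorial * (((1 - t • A)⁻¹ * A) ^ (l + 1)).trace) := by
  induction l generalizing t with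
  | zero => simpa using (A.hasDerivAt_log_det_one_sub_smul ht).deriv
  | succ l ih =>
    have hne : ∀ᶠ s in nhds t, (1 - s • A).det ≠ 0 :=
      (A.hasDerivAt_det_one_sub_smul ht).continuousAt.eventually_ne ht
    have heq : iteratedDeriv (l + 1) (fun s : ℝ => Real.log (1 - s • A).det) =ᶠ[nhds t]
        fun s => -(l.factorial * (((1 - s • A)⁻¹ * A) ^ (l + 1)).trace) :=
      hne.mono fun s hs => ih hs
    rw [iteratedDeriv_succ, heq.deriv_eq,
      ((A.hasDerivAt_trace_inv_one_sub_smul_mul_pow ht (l + 1)).const_mul _).fun_neg.deriv,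
      Nat.factorial_succ]
    push_cast
    ring

end Resolvent

theorem blockDiagPart_eq_blockDiagonal' {N : ℕ} (d : Fin N → ℕ)
    (S : Matrix (blockIdx d) (blockIdx d) ℝ) :
    blockDiagPart d S = blockDiagonal' fun n => blockOf d S n n := by
  ext ⟨m, i⟩ ⟨n, j⟩
  by_cases h : m = n
  · subst h
    simp [blockDiagPart, blockOf]
  · simp [blockDiagPart, blockDiagonal'_apply_ne _ _ _ h, h]

theorem blockDiagPart_mul_blockDiagonal'_inv {N : ℕ} (d : Fin N → ℕ)
    (S : Matrix (blockIdx d) (blockIdx d) ℝ) (hS : S.PosDef) :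
    blockDiagPart d S * blockDiagonal' (fun n => (blockOf d S n n)⁻¹) = 1 := by
  have hblock (n : Fin N) : (blockOf d S n n).PosDef :=
    hS.submatrix (e := Sigma.mk n) sigma_mk_injective
  rw [blockDiagPart_eq_blockDiagonal', ← blockDiagonal'_mul, ← blockDiagonal'_one]
  congr 1
  funext n
  exact mul_nonsing_inv _ (hblock n).det_pos.ne'.isUnit

theorem trace_mul_blockDiagonal' {N : ℕ} (d : Fin N → ℕ)
    (S : Matrix (blockIdx d) (blockIdx d) ℝ)
    (B : (n : Fin N) → Matrix (Fin (d n)) (Fin (d n)) ℝ) :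
    (S * blockDiagonal' B).trace = (blockDiagPart d S * blockDiagonal' B).trace := by
  simp only [trace, diag_apply, mul_apply]
  refine Finset.sum_congr rfl fun i _ => Finset.sum_congr rfl fun j _ => ?_
  by_cases h : i.1 = j.1
  · simp [blockDiagPart, h]
  · simp [blockDiagonal'_apply_ne B j.2 i.2 (Ne.symm h)]

/-- The `l`-th iterated derivative at `t = 0` of `t ↦ −½ ln det(I − tΓ)`, where
`Γ = Σ·D⁻¹ − I`, equals `((l−1)!/2)·tr(Γˡ)` for every `l ≥ 1`; moreover
`tr(Γ) = 0`, so the first derivative vanishes and the cumulants of order `l ≥ 2`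
of the multiinformation density are `κ_l = ((l−1)!/2)·tr(Γˡ)`. -/
theorem iteratedDeriv_cgf {N : ℕ} (hN : 2 ≤ N) (d : Fin N → ℕ)
    (S : Matrix (blockIdx d) (blockIdx d) ℝ) (hS : S.PosDef) :
    (∀ l : ℕ, 1 ≤ l →
      iteratedDeriv l
          (fun t : ℝ => -(1 / 2) *
            Real.log ((1 - t • (S * (blockDiagPart d S)⁻¹ - 1)).det)) 0 =
        ((l - 1).factorial : ℝ) / 2 * ((S * (blockDiagPart d S)⁻¹ - 1) ^ l).trace) ∧
    (S * (blockDiagPart d S)⁻¹ - 1).trace = 0 := by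
  refine ⟨fun l hl => ?_, ?_⟩
  · obtain ⟨k, rfl⟩ := Nat.exists_eq_add_of_le' hl
    rw [iteratedDeriv_const_mul_field, Matrix.iteratedDeriv_log_det_one_sub_smul _ k (by simp)]
    simp only [zero_smul, sub_zero, inv_one, one_mul, Nat.add_sub_cancel]
    ring
  · have hinv := blockDiagPart_mul_blockDiagonal'_inv d S hS
    rw [inv_eq_right_inv hinv, trace_sub, trace_mul_blockDiagonal', hinv, sub_self]
end
end
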